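/- Let λ = (λ₁, λ₂) with 0 < λ₁ < λ₂ and let 𝔤_λ be the associated 6-dimensional oscillator Lie algebra. A linear map ξ : 𝔤_λ → ⋀²𝔤_λ is a Lie bialgebra structure on 𝔤_λ if and only if ξ has one of the following forms: (a) ξ(u) = ad_u†(c₁t₁ + c₂t₂) + e₀ ∧ ((J_a + ad_{u₀})(u)) with c₁, c₂ ∈ ℝ, a ∈ ℝ², u₀ ∈ S; (b) ξ(u) = ad_u†(d E₁₂ + ď Ě₁₂ + c(t₁ − t₂)) + e₀ ∧ ((J_{(a,−a)} + ad_{u₀})(u)) with a, d, ď, c ∈ ℝ, u₀ ∈ S; (c) ξ(u) = ad_u†(d F₁₂ + ď F̌₁₂ + c(t₁ − t₂)) + e₀ ∧ ((J_{(a,a)} + ad_{u₀})(u)) with a, d, ď, c ∈ ℝ, u₀ ∈ S; (d) ξ(u) = ad_u†(d E₁₂ + ď Ě₁₂ + b F₁₂ + b̌ F̌₁₂ + c(t₁ − t₂)) + e₀ ∧ (ad_{u₀}(u)) with b, b̌, d, ď, c ∈ ℝ, u₀ ∈ S. -/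

import Mathlib

open Module LinearMap

noncomputable section

/-- Index type for the basis of an oscillator Lie algebra:
`Sum.inl 0 ↦ e₋₁`, `Sum.inl 1 ↦ e₀`, `Sum.inr (Sum.inl i) ↦ eᵢ`,
`Sum.inr (Sum.inr i) ↦ ěᵢ`. -/
abbrev OscIdx (n : ℕ) := Fin 2 ⊕ (Fin n ⊕ Fin n)

/-- The oscillator Lie algebra `𝔤_λ`: a real Lie algebra `L` together with a basis
`{e₋₁, e₀, e₁, …, eₙ, ě₁, …, ěₙ}` whose nonzero brackets on basis vectors are
`[e₋₁, eⱼ] = λⱼ ěⱼ`, `[e₋₁, ěⱼ] = −λⱼ eⱼ`, `[eⱼ, ěⱼ] = e₀` (all other brackets of the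
basis vectors vanish or follow by antisymmetry; in particular `e₀` is central). -/
structure OscAlg (n : ℕ) (lam : Fin n → ℝ) (L : Type) [LieRing L] [LieAlgebra ℝ L] where
  basis : Basis (OscIdx n) ℝ L
  bracket_em_e : ∀ j, ⁅basis (Sum.inl 0), basis (Sum.inr (Sum.inl j))⁆
      = lam j • basis (Sum.inr (Sum.inr j))
  bracket_em_f : ∀ j, ⁅basis (Sum.inl 0), basis (Sum.inr (Sum.inr j))⁆
      = -lam j • basis (Sum.inr (Sum.inl j))
  bracket_e_f : ∀ i j, ⁅basis (Sum.inr (Sum.inl i)), basis (Sum.inr (Sum.inr j))⁆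
      = if i = j then basis (Sum.inl 1) else 0
  bracket_e_e : ∀ i j, ⁅basis (Sum.inr (Sum.inl i)), basis (Sum.inr (Sum.inl j))⁆ = 0
  bracket_f_f : ∀ i j, ⁅basis (Sum.inr (Sum.inr i)), basis (Sum.inr (Sum.inr j))⁆ = 0
  bracket_e0 : ∀ x : L, ⁅basis (Sum.inl 1), x⁆ = 0

/-- `0 < λ₁ ≤ … ≤ λₙ`: the standing assumption on the parameters of an oscillator
Lie algebra. -/
def OscParam {n : ℕ} (lam : Fin n → ℝ) : Prop := (∀ i, 0 < lam i) ∧ Monotone lam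

/-- Genericity: `0 < λ₁ < … < λₙ` and `λ_k ≠ λ_i + λ_j` for all `i < j < k`. -/
def IsGeneric {n : ℕ} (lam : Fin n → ℝ) : Prop :=
  (∀ i, 0 < lam i) ∧ StrictMono lam ∧
    ∀ i j k : Fin n, i < j → j < k → lam k ≠ lam i + lam j

namespace OscAlg

variable {n : ℕ} {lam : Fin n → ℝ} {L : Type} [LieRing L] [LieAlgebra ℝ L]

/-- `e₋₁`. -/
def em (B : OscAlg n lam L) : L := B.basis (Sum.inl 0)
/-- `e₀`. -/
def e0 (B : OscAlg n lam L) : L := B.basis (Sum.inl 1)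
/-- `eᵢ`. -/
def e (B : OscAlg n lam L) (i : Fin n) : L := B.basis (Sum.inr (Sum.inl i))
/-- `ěᵢ`. -/
def f (B : OscAlg n lam L) (i : Fin n) : L := B.basis (Sum.inr (Sum.inr i))
/-- `e₋₁*`, an element of the dual basis. -/
def em' (B : OscAlg n lam L) : Dual ℝ L := B.basis.coord (Sum.inl 0)
/-- `e₀*`. -/
def e0' (B : OscAlg n lam L) : Dual ℝ L := B.basis.coord (Sum.inl 1)
/-- `eᵢ*`. -/
def e' (B : OscAlg n lam L) (i : Fin n) : Dual ℝ L := B.basis.coord (Sum.inr (Sum.inl i))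
/-- `ěᵢ*`. -/
def f' (B : OscAlg n lam L) (i : Fin n) : Dual ℝ L := B.basis.coord (Sum.inr (Sum.inr i))

/-- The subspace `S` spanned by the `eᵢ, ěᵢ`. -/
def S (B : OscAlg n lam L) : Submodule ℝ L :=
  Submodule.span ℝ (Set.range B.e ∪ Set.range B.f)

/-- The `2`-form `ω` on `𝔤_λ`, viewed as a linear map `𝔤_λ → 𝔤_λ*`:
`ω(e₋₁,·) = ω(e₀,·) = 0`, `ω(eᵢ,eⱼ) = ω(ěᵢ,ěⱼ) = 0`, `ω(eᵢ,ěⱼ) = δᵢⱼ`. -/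
def om (B : OscAlg n lam L) : L →ₗ[ℝ] Dual ℝ L :=
  ∑ i : Fin n, ((B.e' i).smulRight (B.f' i) - (B.f' i).smulRight (B.e' i))

/-- The derivation `J_a` of `𝔤_λ` given by `J_a(e₋₁) = J_a(e₀) = 0`, `J_a(eᵢ) = aᵢ ěᵢ`,
`J_a(ěᵢ) = −aᵢ eᵢ`. -/
def Ja (B : OscAlg n lam L) (a : Fin n → ℝ) : L →ₗ[ℝ] L :=
  B.basis.constr ℝ (Sum.elim (fun _ => (0 : L))
    (Sum.elim (fun i => a i • B.f i) (fun i => -(a i) • B.e i)))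

end OscAlg

section Bivectors

variable {L : Type} [LieRing L] [LieAlgebra ℝ L]

/-- `x ∧ y`, viewed as the linear map `𝔤* → 𝔤`, `α ↦ α(x) y − α(y) x`; this corresponds
to the skew-symmetric bilinear form `(α,β) ↦ α(x)β(y) − α(y)β(x)` on `𝔤*`. -/
def wedge (x y : L) : Dual ℝ L →ₗ[ℝ] L :=
  (Module.Dual.eval ℝ L x).smulRight y - (Module.Dual.eval ℝ L y).smulRight x

/-- A bivector `r ∈ ⋀²𝔤`, identified with the linear map `r_# : 𝔤* → 𝔤` of the
corresponding skew-symmetric bilinear form on `𝔤*` (so `r(α,β) = β(r_#(α))`). -/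
def IsBivector (r : Dual ℝ L →ₗ[ℝ] L) : Prop := ∀ α β : Dual ℝ L, α (r β) = - β (r α)

/-- The coadjoint action `ad*_u α := α ∘ ad_u`. -/
def coad (u : L) : Dual ℝ L →ₗ[ℝ] Dual ℝ L := (LieAlgebra.ad ℝ L u).dualMap

/-- `J† r` for an endomorphism `J` of `𝔤`; in terms of bilinear forms,
`(J† r)(α,β) = r(α∘J, β) + r(α, β∘J)`. -/
def dag (J : L →ₗ[ℝ] L) (r : Dual ℝ L →ₗ[ℝ] L) : Dual ℝ L →ₗ[ℝ] L :=
  r ∘ₗ J.dualMap + J ∘ₗ r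

/-- The adjoint action `ad_u† r` of `u ∈ 𝔤` on bivectors:
`(ad_u† r)(α,β) = r(ad*_u α, β) + r(α, ad*_u β)`. -/
def adDag (u : L) (r : Dual ℝ L →ₗ[ℝ] L) : Dual ℝ L →ₗ[ℝ] L :=
  dag (LieAlgebra.ad ℝ L u) r

/-- The Schouten bracket `[r,r]` of a bivector with itself:
`[r,r](α,β,γ) = 2α([r_#β, r_#γ]) + 2β([r_#γ, r_#α]) + 2γ([r_#α, r_#β])`. -/
def schouten (r : Dual ℝ L →ₗ[ℝ] L) (α β γ : Dual ℝ L) : ℝ :=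
  2 * α ⁅r β, r γ⁆ + 2 * β ⁅r γ, r α⁆ + 2 * γ ⁅r α, r β⁆

/-- `r` is a solution of the classical Yang–Baxter equation: `[r,r] = 0`. -/
def IsCYBE (r : Dual ℝ L →ₗ[ℝ] L) : Prop := ∀ α β γ : Dual ℝ L, schouten r α β γ = 0

/-- `r` is a solution of the generalized classical Yang–Baxter equation:
`ad_u [r,r] = 0` for all `u`. -/
def IsGCYBE (r : Dual ℝ L →ₗ[ℝ] L) : Prop :=
  ∀ (u : L) (α β γ : Dual ℝ L),
    schouten r (coad u α) β γ + schouten r α (coad u β) γ + schouten r α β (coad u γ) = 0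

/-- A derivation of the Lie algebra `L`. -/
def IsDerivation (J : L →ₗ[ℝ] L) : Prop := ∀ x y : L, J ⁅x, y⁆ = ⁅J x, y⁆ + ⁅x, J y⁆

/-- The 1-cocycle condition for `ξ : 𝔤 → ⋀²𝔤` with respect to the adjoint action:
`ξ([u,v]) = ad_u† ξ(v) − ad_v† ξ(u)`. -/
def IsCocycle (ξ : L →ₗ[ℝ] (Dual ℝ L →ₗ[ℝ] L)) : Prop :=
  ∀ u v : L, ξ ⁅u, v⁆ = adDag u (ξ v) - adDag v (ξ u)

/-- The dual bracket `[α,β]*` associated to `ξ : 𝔤 → ⋀²𝔤`: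
`[α,β]*(u) = ξ(u)(α,β)`. -/
def dualBr (ξ : L →ₗ[ℝ] (Dual ℝ L →ₗ[ℝ] L)) (α β : Dual ℝ L) : Dual ℝ L :=
  (β : L →ₗ[ℝ] ℝ) ∘ₗ (ξ.flip α)

/-- `ξ : 𝔤 → ⋀²𝔤` is a Lie bialgebra structure: `ξ` takes values in bivectors, is a
1-cocycle, and the dual bracket satisfies the Jacobi identity. -/
def IsBialgebra (ξ : L →ₗ[ℝ] (Dual ℝ L →ₗ[ℝ] L)) : Prop :=
  (∀ (u : L) (α β : Dual ℝ L), α (ξ u β) = - β (ξ u α)) ∧ IsCocycle ξ ∧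
  ∀ α β γ : Dual ℝ L,
    dualBr ξ (dualBr ξ α β) γ + dualBr ξ (dualBr ξ β γ) α + dualBr ξ (dualBr ξ γ α) β = 0

end Bivectors

namespace OscAlg

variable {n : ℕ} {lam : Fin n → ℝ} {L : Type} [LieRing L] [LieAlgebra ℝ L]

/-- Membership in `⋀²S`: a bivector `r` with `r_#(e₋₁*) = r_#(e₀*) = 0` and
`Im r_# ⊆ S`. -/
def InW2S (B : OscAlg n lam L) (r : Dual ℝ L →ₗ[ℝ] L) : Prop :=
  IsBivector r ∧ r B.em' = 0 ∧ r B.e0' = 0 ∧ ∀ α : Dual ℝ L, r α ∈ B.S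

/-- `ω_{r₁,r₂}(α,β) = (1/2)(ω(r₁_#(α), r₂_#(β)) + ω(r₂_#(α), r₁_#(β)))`. -/
def omPair (B : OscAlg n lam L) (r₁ r₂ : Dual ℝ L →ₗ[ℝ] L) (α β : Dual ℝ L) : ℝ :=
  (1/2) * (B.om (r₁ α) (r₂ β) + B.om (r₂ α) (r₁ β))

end OscAlg

namespace OscAlg

variable {lam : Fin 2 → ℝ} {L : Type} [LieRing L] [LieAlgebra ℝ L]

/-- `tᵢ = eᵢ ∧ ěᵢ`. -/
def tI (B : OscAlg 2 lam L) (i : Fin 2) : Dual ℝ L →ₗ[ℝ] L := wedge (B.e i) (B.f i)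

/-- `E₁₂ = e₁∧ě₂ + ě₁∧e₂`. -/
def E12 (B : OscAlg 2 lam L) : Dual ℝ L →ₗ[ℝ] L :=
  wedge (B.e 0) (B.f 1) + wedge (B.f 0) (B.e 1)

/-- `Ě₁₂ = −e₁∧e₂ + ě₁∧ě₂`. -/
def E12c (B : OscAlg 2 lam L) : Dual ℝ L →ₗ[ℝ] L :=
  -wedge (B.e 0) (B.e 1) + wedge (B.f 0) (B.f 1)

/-- `F₁₂ = −e₁∧ě₂ + ě₁∧e₂`. -/
def F12 (B : OscAlg 2 lam L) : Dual ℝ L →ₗ[ℝ] L :=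
  -wedge (B.e 0) (B.f 1) + wedge (B.f 0) (B.e 1)

/-- `F̌₁₂ = e₁∧e₂ + ě₁∧ě₂`. -/
def F12c (B : OscAlg 2 lam L) : Dual ℝ L →ₗ[ℝ] L :=
  wedge (B.e 0) (B.e 1) + wedge (B.f 0) (B.f 1)

end OscAlg

/-! ### Brackets and coadjoint action on the distinguished basis -/

namespace OscAlg

variable {n : ℕ} {lam : Fin n → ℝ} {L : Type} [LieRing L] [LieAlgebra ℝ L] (B : OscAlg n lam L)

@[simp] lemma em'_em : B.em' B.em = 1 := by simp [em', em]
@[simp] lemma em'_e0 : B.em' B.e0 = 0 := by simp [em', e0]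
@[simp] lemma em'_e (i : Fin n) : B.em' (B.e i) = 0 := by simp [em', e]
@[simp] lemma em'_f (i : Fin n) : B.em' (B.f i) = 0 := by simp [em', f]
@[simp] lemma e0'_em : B.e0' B.em = 0 := by simp [e0', em]
@[simp] lemma e0'_e0 : B.e0' B.e0 = 1 := by simp [e0', e0]
@[simp] lemma e0'_e (i : Fin n) : B.e0' (B.e i) = 0 := by simp [e0', e]
@[simp] lemma e0'_f (i : Fin n) : B.e0' (B.f i) = 0 := by simp [e0', f]
@[simp] lemma e'_em (i : Fin n) : B.e' i B.em = 0 := by simp [e', em]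
@[simp] lemma e'_e0 (i : Fin n) : B.e' i B.e0 = 0 := by simp [e', e0]
@[simp] lemma e'_e (i j : Fin n) : B.e' i (B.e j) = if j = i then 1 else 0 := by
  simp [e', e, Finsupp.single_apply]
@[simp] lemma e'_f (i j : Fin n) : B.e' i (B.f j) = 0 := by simp [e', f]
@[simp] lemma f'_em (i : Fin n) : B.f' i B.em = 0 := by simp [f', em]
@[simp] lemma f'_e0 (i : Fin n) : B.f' i B.e0 = 0 := by simp [f', e0]
@[simp] lemma f'_e (i j : Fin n) : B.f' i (B.e j) = 0 := by simp [f', e]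
@[simp] lemma f'_f (i j : Fin n) : B.f' i (B.f j) = if j = i then 1 else 0 := by
  simp [f', f, Finsupp.single_apply]

@[simp] lemma lie_em_e (j : Fin n) : ⁅B.em, B.e j⁆ = lam j • B.f j := B.bracket_em_e j
@[simp] lemma lie_em_f (j : Fin n) : ⁅B.em, B.f j⁆ = -(lam j • B.e j) := by
  rw [← neg_smul]; exact B.bracket_em_f j
@[simp] lemma lie_e_f (i j : Fin n) : ⁅B.e i, B.f j⁆ = if i = j then B.e0 else 0 :=
  B.bracket_e_f i j
@[simp] lemma lie_e_e (i j : Fin n) : ⁅B.e i, B.e j⁆ = 0 := B.bracket_e_e i j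
@[simp] lemma lie_f_f (i j : Fin n) : ⁅B.f i, B.f j⁆ = 0 := B.bracket_f_f i j
@[simp] lemma lie_e0_left (x : L) : ⁅B.e0, x⁆ = 0 := B.bracket_e0 x
@[simp] lemma lie_e0_right (x : L) : ⁅x, B.e0⁆ = 0 := by rw [← lie_skew]; simp
@[simp] lemma lie_e_em (j : Fin n) : ⁅B.e j, B.em⁆ = -(lam j • B.f j) := by
  rw [← lie_skew]; simp
@[simp] lemma lie_f_em (j : Fin n) : ⁅B.f j, B.em⁆ = lam j • B.e j := by
  rw [← lie_skew]; simp
@[simp] lemma lie_f_e (i j : Fin n) : ⁅B.f i, B.e j⁆ = if i = j then -B.e0 else 0 := by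
  rw [← lie_skew, lie_e_f]; simp only [eq_comm]; split_ifs <;> simp

/-- Two linear maps out of `𝔤_λ` agree if they agree on the distinguished basis. -/
lemma linearMap_ext {M : Type*} [AddCommGroup M] [Module ℝ M] {φ ψ : L →ₗ[ℝ] M}
    (hm : φ B.em = ψ B.em) (h0 : φ B.e0 = ψ B.e0) (he : ∀ i, φ (B.e i) = ψ (B.e i))
    (hf : ∀ i, φ (B.f i) = ψ (B.f i)) : φ = ψ := by
  refine B.basis.ext fun i => ?_
  rcases i with i | i | i
  · fin_cases i
    exacts [hm, h0]
  · exact he i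
  · exact hf i

/-- Two linear maps out of `𝔤_λ*` agree if they agree on the dual basis. -/
lemma dualMap_ext {M : Type*} [AddCommGroup M] [Module ℝ M] {φ ψ : Dual ℝ L →ₗ[ℝ] M}
    (hm : φ B.em' = ψ B.em') (h0 : φ B.e0' = ψ B.e0') (he : ∀ i, φ (B.e' i) = ψ (B.e' i))
    (hf : ∀ i, φ (B.f' i) = ψ (B.f' i)) : φ = ψ := by
  refine B.basis.dualBasis.ext fun i => ?_
  rw [Basis.coe_dualBasis]
  rcases i with i | i | i
  · fin_cases i
    exacts [hm, h0]
  · exact he i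
  · exact hf i

/-- Expansion of a linear form in the dual basis. -/
lemma dual_eq_sum (α : Dual ℝ L) :
    α = α B.em • B.em' + α B.e0 • B.e0' + ∑ i, (α (B.e i) • B.e' i + α (B.f i) • B.f' i) := by
  refine B.linearMap_ext ?_ ?_ (fun i => ?_) (fun i => ?_) <;> simp

/-- Vectors are separated by the dual basis. -/
lemma eq_of_coord {x y : L} (hm : B.em' x = B.em' y) (h0 : B.e0' x = B.e0' y)
    (he : ∀ i, B.e' i x = B.e' i y) (hf : ∀ i, B.f' i x = B.f' i y) : x = y := by
  refine B.basis.ext_elem fun i => ?_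
  rcases i with i | i | i
  · fin_cases i
    exacts [hm, h0]
  · exact he i
  · exact hf i

end OscAlg

section Bivectors

variable {L : Type} [LieRing L] [LieAlgebra ℝ L]

@[simp] lemma wedge_apply (x y : L) (α : Dual ℝ L) : wedge x y α = α x • y - α y • x := by
  simp [wedge]

@[simp] lemma coad_apply (u x : L) (α : Dual ℝ L) : coad u α x = α ⁅u, x⁆ := rfl

lemma adDag_apply (u : L) (r : Dual ℝ L →ₗ[ℝ] L) (α : Dual ℝ L) :
    adDag u r α = r (coad u α) + ⁅u, r α⁆ := rfl

lemma apply_adDag (u : L) (r : Dual ℝ L →ₗ[ℝ] L) (α β : Dual ℝ L) :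
    β (adDag u r α) = β (r (coad u α)) + coad u β (r α) := by
  simp [adDag_apply]

lemma adDag_wedge (u x y : L) : adDag u (wedge x y) = wedge ⁅u, x⁆ y + wedge x ⁅u, y⁆ := by
  ext α
  simp [adDag_apply]
  abel

lemma IsCocycle.apply {ξ : L →ₗ[ℝ] (Dual ℝ L →ₗ[ℝ] L)} (h : IsCocycle ξ) (u v : L)
    (α β : Dual ℝ L) :
    β (ξ ⁅u, v⁆ α) = β (ξ v (coad u α)) + coad u β (ξ v α)
      - (β (ξ u (coad v α)) + coad v β (ξ u α)) := by
  rw [h u v, LinearMap.sub_apply, map_sub, apply_adDag, apply_adDag]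

end Bivectors

namespace OscAlg

variable {n : ℕ} {lam : Fin n → ℝ} {L : Type} [LieRing L] [LieAlgebra ℝ L] (B : OscAlg n lam L)

@[simp] lemma coad_e0 (α : Dual ℝ L) : coad B.e0 α = 0 := by
  ext x; simp
@[simp] lemma coad_em_em' : coad B.em B.em' = 0 := by
  refine B.linearMap_ext ?_ ?_ (fun i => ?_) (fun i => ?_) <;> simp
@[simp] lemma coad_em_e0' : coad B.em B.e0' = 0 := by
  refine B.linearMap_ext ?_ ?_ (fun i => ?_) (fun i => ?_) <;> simp
@[simp] lemma coad_em_e' (j : Fin n) : coad B.em (B.e' j) = -(lam j • B.f' j) := by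
  refine B.linearMap_ext ?_ ?_ (fun i => ?_) (fun i => ?_) <;> simp
  split_ifs <;> simp [*]
@[simp] lemma coad_em_f' (j : Fin n) : coad B.em (B.f' j) = lam j • B.e' j := by
  refine B.linearMap_ext ?_ ?_ (fun i => ?_) (fun i => ?_) <;> simp
  split_ifs <;> simp [*]
@[simp] lemma coad_e_em' (i : Fin n) : coad (B.e i) B.em' = 0 := by
  refine B.linearMap_ext ?_ ?_ (fun k => ?_) (fun k => ?_) <;> simp [apply_ite]
@[simp] lemma coad_e_e0' (i : Fin n) : coad (B.e i) B.e0' = B.f' i := by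
  refine B.linearMap_ext ?_ ?_ (fun k => ?_) (fun k => ?_) <;> simp [apply_ite, eq_comm]
@[simp] lemma coad_e_e' (i j : Fin n) : coad (B.e i) (B.e' j) = 0 := by
  refine B.linearMap_ext ?_ ?_ (fun k => ?_) (fun k => ?_) <;> simp [apply_ite]
@[simp] lemma coad_e_f' (i j : Fin n) :
    coad (B.e i) (B.f' j) = if i = j then -(lam i • B.em') else 0 := by
  refine B.linearMap_ext ?_ ?_ (fun k => ?_) (fun k => ?_) <;> split_ifs <;> simp [apply_ite, *]
@[simp] lemma coad_f_em' (i : Fin n) : coad (B.f i) B.em' = 0 := by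
  refine B.linearMap_ext ?_ ?_ (fun k => ?_) (fun k => ?_) <;> simp [apply_ite]
@[simp] lemma coad_f_e0' (i : Fin n) : coad (B.f i) B.e0' = -B.e' i := by
  refine B.linearMap_ext ?_ ?_ (fun k => ?_) (fun k => ?_) <;> simp [apply_ite, eq_comm]
@[simp] lemma coad_f_e' (i j : Fin n) :
    coad (B.f i) (B.e' j) = if i = j then lam i • B.em' else 0 := by
  refine B.linearMap_ext ?_ ?_ (fun k => ?_) (fun k => ?_) <;> split_ifs <;> simp [apply_ite, *]
@[simp] lemma coad_f_f' (i j : Fin n) : coad (B.f i) (B.f' j) = 0 := by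
  refine B.linearMap_ext ?_ ?_ (fun k => ?_) (fun k => ?_) <;> simp [apply_ite]

/-- Brackets with elements of the ideal `ℝe₀ ⊕ S` are given by `ad_{e₋₁}` and `ω`. -/
lemma lie_of_em'_eq_zero (u : L) {x : L} (hx : B.em' x = 0) :
    ⁅u, x⁆ = B.em' u • ⁅B.em, x⁆ + B.om u x • B.e0 := by
  have hm : B.om B.em x = 0 := by simp [om]
  have h0 : B.om B.e0 x = 0 := by simp [om]
  have he (i : Fin n) : B.om (B.e i) x = B.f' i x := by simp [om]
  have hf (i : Fin n) : B.om (B.f i) x = -B.e' i x := by simp [om]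
  suffices h : ((LieAlgebra.ad ℝ L : L →ₗ[ℝ] Module.End ℝ L).flip x : L →ₗ[ℝ] L)
      = B.em'.smulRight ⁅B.em, x⁆ + (B.om.flip x).smulRight B.e0 by
    simpa using LinearMap.congr_fun h u
  refine B.linearMap_ext ?_ ?_ (fun i => ?_) (fun i => ?_) <;> simp [hm, h0, he, hf]
  all_goals
    refine B.eq_of_coord ?_ ?_ (fun k => ?_) (fun k => ?_) <;> simp only [← coad_apply] <;>
      simp [apply_ite, hx, ite_apply]

end OscAlg

/-! ### Rigidity of cocycles -/

namespace OscAlg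

section

variable {n : ℕ} {lam : Fin n → ℝ} {L : Type} [LieRing L] [LieAlgebra ℝ L] (B : OscAlg n lam L)

/-- A bivector vanishes if its components in the distinguished basis do. -/
lemma bivector_eq_zero {r : Dual ℝ L →ₗ[ℝ] L} (hr : IsBivector r)
    (m0 : B.e0' (r B.em') = 0) (me : ∀ i, B.e' i (r B.em') = 0) (mf : ∀ i, B.f' i (r B.em') = 0)
    (ze : ∀ i, B.e' i (r B.e0') = 0) (zf : ∀ i, B.f' i (r B.e0') = 0)
    (ee : ∀ i j, B.e' i (r (B.e' j)) = 0) (ef : ∀ i j, B.f' i (r (B.e' j)) = 0)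
    (ff : ∀ i j, B.f' i (r (B.f' j)) = 0) : r = 0 := by
  have diag (α : Dual ℝ L) : α (r α) = 0 := by linarith [hr α α]
  refine B.dualMap_ext ?_ ?_ (fun i => ?_) (fun i => ?_) <;>
    refine B.eq_of_coord ?_ ?_ (fun j => ?_) (fun j => ?_) <;>
    rw [LinearMap.zero_apply, map_zero] <;>
    first
      | simp only [diag, m0, me, mf, ze, zf, ee, ef, ff]
      | rw [hr]; simp only [m0, me, mf, ze, zf, ef, neg_zero]

variable {η : L →ₗ[ℝ] (Dual ℝ L →ₗ[ℝ] L)}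

/-- A cocycle with values in bivectors vanishes on the central element `e₀`. -/
lemma cocycle_e0_eq_zero (hlam : ∀ i, lam i ≠ 0) [Nonempty (Fin n)]
    (hs : ∀ u, IsBivector (η u)) (hc : IsCocycle η) : η B.e0 = 0 := by
  have diag (u : L) (α : Dual ℝ L) : α (η u α) = 0 := by linarith [hs u α α]
  have m0 : B.e0' (η B.e0 B.em') = 0 := by
    rw [hs, neg_eq_zero]
    obtain ⟨i⟩ := ‹Nonempty (Fin n)›
    simpa [-coad_apply, hlam, diag] using hc.apply B.e0 (B.f i) B.e0' (B.e' i)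
  have m0' : B.em' (η B.e0 B.e0') = 0 := by rw [hs, m0, neg_zero]
  refine B.bivector_eq_zero (hs _) m0 (fun i => ?_) (fun i => ?_) (fun i => ?_) (fun i => ?_)
    (fun i j => ?_) (fun i j => ?_) (fun i j => ?_)
  · simpa [-coad_apply, hlam] using hc.apply B.em B.e0 B.em' (B.f' i)
  · simpa [-coad_apply, hlam] using hc.apply B.em B.e0 B.em' (B.e' i)
  · simpa [-coad_apply, hlam] using hc.apply B.em B.e0 B.e0' (B.f' i)
  · simpa [-coad_apply, hlam] using hc.apply B.em B.e0 B.e0' (B.e' i)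
  · have := hc.apply B.e0 (B.f j) B.e0' (B.e' i)
    rcases eq_or_ne j i with rfl | h
    · exact diag _ _
    · simpa [-coad_apply, h, eq_comm] using this
  · simpa [-coad_apply, eq_comm] using hc.apply B.e0 (B.f j) B.e0' (B.f' i)
  · have := hc.apply B.e0 (B.e j) B.e0' (B.f' i)
    rcases eq_or_ne j i with rfl | h
    · exact diag _ _
    · simpa [-coad_apply, h, eq_comm] using this

end

variable {lam : Fin 2 → ℝ} {L : Type} [LieRing L] [LieAlgebra ℝ L] (B : OscAlg 2 lam L)
  {η : L →ₗ[ℝ] (Dual ℝ L →ₗ[ℝ] L)}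

/-- The values of a cocycle on `S` have no component in `e₋₁ ∧ S`. -/
lemma cocycle_em'_comp (hlam : ∀ i, lam i ≠ 0) (hs : ∀ u, IsBivector (η u)) (hc : IsCocycle η)
    (j k : Fin 2) :
    B.e' j (η (B.e k) B.em') = 0 ∧ B.f' j (η (B.e k) B.em') = 0 ∧
      B.e' j (η (B.f k) B.em') = 0 ∧ B.f' j (η (B.f k) B.em') = 0 := by
  have h0 := B.cocycle_e0_eq_zero hlam hs hc
  rcases eq_or_ne j k with rfl | hjk
  · obtain ⟨k, hkj⟩ := exists_ne j
    have a₁ := hc.apply (B.e j) (B.e k) (B.e' j) (B.f' k)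
    have a₂ := hc.apply (B.e k) (B.f j) (B.f' k) (B.f' j)
    have a₃ := hc.apply B.em (B.e j) B.em' (B.e' j)
    have a₄ := hc.apply (B.e j) (B.f j) (B.e' j) (B.f' j)
    simp [-coad_apply, hlam, hkj, hkj.symm, h0] at a₁ a₂ a₃ a₄
    rw [hs] at a₁ a₄
    have a₅ : lam j * B.f' j (η (B.e j) B.em') = 0 := by linarith
    have a₆ : lam j * B.e' j (η (B.f j) B.em') = 0 := by linarith
    simp only [mul_eq_zero, hlam, false_or] at a₅ a₆
    exact ⟨by linarith, a₅, a₆, a₂⟩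
  · have a₁ := hc.apply (B.e j) (B.e k) (B.e' j) (B.f' j)
    have a₂ := hc.apply (B.e k) (B.f j) (B.e' j) (B.f' j)
    have a₃ := hc.apply (B.e j) (B.f k) (B.e' j) (B.f' j)
    have a₄ := hc.apply (B.f j) (B.f k) (B.e' j) (B.f' j)
    simp [-coad_apply, hlam, hjk, hjk.symm] at a₁ a₂ a₃ a₄
    rw [hs] at a₁ a₃
    exact ⟨by linarith, a₂, by linarith, a₄⟩

/-- A cocycle with values in bivectors is determined by its value on `e₋₁` and by the components
of its value on `eₖ` along `e₀ ∧ eₖ` and `e₀ ∧ ěₖ`. -/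
lemma cocycle_eq_zero (hlam : ∀ i, lam i ≠ 0) (hsq : ∀ j k, j ≠ k → lam j ^ 2 ≠ lam k ^ 2)
    (hs : ∀ u, IsBivector (η u)) (hc : IsCocycle η)
    (me : ∀ i, B.e' i (η B.em B.em') = 0) (mf : ∀ i, B.f' i (η B.em B.em') = 0)
    (ze : ∀ i, B.e' i (η B.em B.e0') = 0) (zf : ∀ i, B.f' i (η B.em B.e0') = 0)
    (ee : ∀ i j, B.e' i (η B.em (B.e' j)) = 0)
    (ef : ∀ i j, i ≠ j → B.f' i (η B.em (B.e' j)) = 0)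
    (ff : ∀ i j, B.f' i (η B.em (B.f' j)) = 0)
    (ze' : ∀ k, B.e' k (η (B.e k) B.e0') = 0) (zf' : ∀ k, B.f' k (η (B.e k) B.e0') = 0) :
    η = 0 := by
  have h0 := B.cocycle_e0_eq_zero hlam hs hc
  have hm := B.cocycle_em'_comp hlam hs hc
  have diag (u : L) (α : Dual ℝ L) : α (η u α) = 0 := by linarith [hs u α α]
  have zm (u : L) : B.em' (η u B.e0') = -(B.e0' (η u B.em')) := hs _ _ _
  have em (u : L) (i) : B.em' (η u (B.e' i)) = -(B.e' i (η u B.em')) := hs _ _ _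
  have fe (u : L) (i j) : B.e' i (η u (B.f' j)) = -(B.f' j (η u (B.e' i))) := hs _ _ _
  have diagonal (k : Fin 2) : B.e0' (η B.em B.em') = 0 ∧ B.f' k (η B.em (B.e' k)) = 0 ∧
      B.e' k (η (B.f k) B.e0') = 0 ∧ B.f' k (η (B.f k) B.e0') = 0 := by
    have c₁ := hc.apply B.em (B.e k) B.e0' (B.e' k)
    have c₂ := hc.apply B.em (B.f k) B.e0' (B.f' k)
    have c₃ := hc.apply B.em (B.e k) B.e0' (B.f' k)
    have c₄ := hc.apply B.em (B.f k) B.e0' (B.e' k)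
    simp [-coad_apply, diag, zm, fe, ze', zf'] at c₁ c₂ c₃ c₄
    have c₅ : lam k * B.e' k (η (B.f k) B.e0') = 0 := by linarith
    have c₆ : lam k * B.f' k (η (B.f k) B.e0') = 0 := by linarith
    have c₇ : lam k * B.e0' (η B.em B.em') = 0 := by linarith
    simp only [mul_eq_zero, hlam, false_or] at c₅ c₆ c₇
    exact ⟨c₇, by linarith, c₅, c₆⟩
  have E₁ (k) := hc.apply B.em (B.f k) B.em' B.e0'
  have E₂ (k) := hc.apply B.em (B.f k) (B.e' k) (B.f' k)
  have F₁ (k) := hc.apply B.em (B.e k) B.em' B.e0'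
  have F₂ (k) := hc.apply B.em (B.e k) (B.e' k) (B.f' k)
  simp [-coad_apply, -Fin.forall_fin_two, hlam, diag, me, mf, em] at E₁ E₂ F₁ F₂
  have on_S (k : Fin 2) : η (B.e k) = 0 ∧ η (B.f k) = 0 := by
    obtain ⟨j, hjk⟩ := exists_ne k
    have cover (i : Fin 2) : i = k ∨ i = j := by omega
    have E₃ := hc.apply B.em (B.f k) (B.e' j) (B.f' j)
    have F₃ := hc.apply B.em (B.e k) (B.e' j) (B.f' j)
    have E₄ := hc.apply B.em (B.f j) (B.e' k) (B.f' k)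
    have F₄ := hc.apply B.em (B.e j) (B.e' k) (B.f' k)
    have E₅ := hc.apply (B.e k) (B.e j) (B.e0') (B.e' k)
    have E₆ := hc.apply (B.e k) (B.f j) (B.e0') (B.f' k)
    have E₇ := hc.apply (B.e k) (B.f j) (B.e0') (B.e' k)
    have E₈ := hc.apply (B.e k) (B.e j) (B.e0') (B.f' k)
    have F₅ := hc.apply (B.e j) (B.f k) (B.e0') (B.e' k)
    have F₆ := hc.apply (B.f k) (B.f j) (B.e0') (B.f' k)
    have F₇ := hc.apply (B.f k) (B.f j) (B.e0') (B.e' k)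
    have F₈ := hc.apply (B.e j) (B.f k) (B.e0') (B.f' k)
    have b₁ := hc.apply B.em (B.e k) B.e0' (B.f' j)
    have b₂ := hc.apply B.em (B.f k) B.e0' (B.e' j)
    have b₃ := hc.apply B.em (B.e k) B.e0' (B.e' j)
    have b₄ := hc.apply B.em (B.f k) B.e0' (B.f' j)
    simp [-coad_apply, hlam, diag, zm, fe, ee, ef, ff, hjk, hjk.symm, E₁, F₁]
      at E₃ F₃ E₄ F₄ E₅ E₆ E₇ E₈ F₅ F₆ F₇ F₈ b₁ b₂ b₃ b₄
    have hne : lam k ^ 2 - lam j ^ 2 ≠ 0 := sub_ne_zero.mpr (hsq k j hjk.symm)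
    have b₅ : (lam k ^ 2 - lam j ^ 2) * B.e' j (η (B.e k) B.e0') = 0 := by
      linear_combination lam k * b₂ + lam j * b₁
    have b₆ : (lam k ^ 2 - lam j ^ 2) * B.f' j (η (B.f k) B.e0') = 0 := by
      linear_combination lam k * b₁ + lam j * b₂
    have b₇ : (lam k ^ 2 - lam j ^ 2) * B.f' j (η (B.e k) B.e0') = 0 := by
      linear_combination -lam k * b₄ - lam j * b₃
    have b₈ : (lam k ^ 2 - lam j ^ 2) * B.e' j (η (B.f k) B.e0') = 0 := by
      linear_combination lam k * b₃ + lam j * b₄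
    simp only [mul_eq_zero, hne, false_or] at b₅ b₆ b₇ b₈
    constructor
    · refine B.bivector_eq_zero (hs _) (E₁ k) (fun i => (hm i k).1) (fun i => (hm i k).2.1)
        (fun i => ?_) (fun i => ?_) (fun i i' => ?_) (fun i i' => ?_) (fun i i' => ?_)
      · rcases cover i with rfl | rfl
        exacts [ze' _, b₅]
      · rcases cover i with rfl | rfl
        exacts [zf' _, b₇]
      · rcases cover i with h | h <;> rcases cover i' with h' | h' <;> rw [h, h'] <;>
          linarith [hs (B.e k) (B.e' k) (B.e' j), hs (B.e k) (B.e' k) (B.e' k),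
            hs (B.e k) (B.e' j) (B.e' j)]
      · rcases cover i with h | h <;> rcases cover i' with h' | h' <;> rw [h, h'] <;>
          linarith [E₂ k]
      · rcases cover i with h | h <;> rcases cover i' with h' | h' <;> rw [h, h'] <;>
          linarith [hs (B.e k) (B.f' k) (B.f' j), hs (B.e k) (B.f' k) (B.f' k),
            hs (B.e k) (B.f' j) (B.f' j)]
    · refine B.bivector_eq_zero (hs _) (F₁ k) (fun i => (hm i k).2.2.1) (fun i => (hm i k).2.2.2)
        (fun i => ?_) (fun i => ?_) (fun i i' => ?_) (fun i i' => ?_) (fun i i' => ?_)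
      · rcases cover i with rfl | rfl
        exacts [(diagonal _).2.2.1, b₈]
      · rcases cover i with rfl | rfl
        exacts [(diagonal _).2.2.2, b₆]
      · rcases cover i with h | h <;> rcases cover i' with h' | h' <;> rw [h, h'] <;>
          linarith [hs (B.f k) (B.e' k) (B.e' j), hs (B.f k) (B.e' k) (B.e' k),
            hs (B.f k) (B.e' j) (B.e' j)]
      · rcases cover i with h | h <;> rcases cover i' with h' | h' <;> rw [h, h'] <;>
          linarith [F₂ k]
      · rcases cover i with h | h <;> rcases cover i' with h' | h' <;> rw [h, h'] <;>
          linarith [hs (B.f k) (B.f' k) (B.f' j), hs (B.f k) (B.f' k) (B.f' k),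
            hs (B.f k) (B.f' j) (B.f' j)]
  refine B.linearMap_ext ?_ h0 (fun k => (on_S k).1) (fun k => (on_S k).2)
  refine B.bivector_eq_zero (hs _) (diagonal 0).1 me mf ze zf ee (fun i j => ?_) ff
  rcases eq_or_ne i j with rfl | hij
  exacts [(diagonal i).2.1, ef i j hij]

end OscAlg

/-! ### Standard cocycles -/

section Cocycles

variable {L : Type} [LieRing L] [LieAlgebra ℝ L]

/-- The linear map `y ↦ x ∧ y`. -/
def wedgeLeft (x : L) : L →ₗ[ℝ] (Dual ℝ L →ₗ[ℝ] L) where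
  toFun y := wedge x y
  map_add' y z := by ext α; simp; module
  map_smul' t y := by ext α; simp; module

@[simp] lemma wedgeLeft_apply (x y : L) : wedgeLeft x y = wedge x y := rfl

/-- The coboundary `u ↦ ad_u† r` of a bivector. -/
def coboundary (r : Dual ℝ L →ₗ[ℝ] L) : L →ₗ[ℝ] (Dual ℝ L →ₗ[ℝ] L) where
  toFun u := adDag u r
  map_add' u v := by
    have h (α : Dual ℝ L) : coad (u + v) α = coad u α + coad v α := by ext; simp
    ext α; simp [adDag_apply, h]; abel
  map_smul' t u := by
    have h (α : Dual ℝ L) : coad (t • u) α = t • coad u α := by ext; simp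
    ext α; simp [adDag_apply, h]

@[simp] lemma coboundary_apply (r : Dual ℝ L →ₗ[ℝ] L) (u : L) : coboundary r u = adDag u r := rfl

lemma adDag_add (u : L) (r s : Dual ℝ L →ₗ[ℝ] L) : adDag u (r + s) = adDag u r + adDag u s := by
  ext α; simp [adDag_apply]; abel

lemma adDag_sub (u : L) (r s : Dual ℝ L →ₗ[ℝ] L) : adDag u (r - s) = adDag u r - adDag u s := by
  ext α; simp [adDag_apply]; abel

lemma adDag_neg (u : L) (r : Dual ℝ L →ₗ[ℝ] L) : adDag u (-r) = -adDag u r := by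
  ext α; simp [adDag_apply]; abel

lemma adDag_smul (u : L) (t : ℝ) (r : Dual ℝ L →ₗ[ℝ] L) : adDag u (t • r) = t • adDag u r := by
  ext α; simp [adDag_apply]

lemma isCocycle_coboundary (r : Dual ℝ L →ₗ[ℝ] L) : IsCocycle (coboundary r) := by
  intro u v
  have h (α : Dual ℝ L) : coad ⁅u, v⁆ α = coad v (coad u α) - coad u (coad v α) := by
    ext x
    simp only [coad_apply, LinearMap.sub_apply, lie_lie, map_sub]
  ext α
  simp [adDag_apply, h]
  abel

lemma IsCocycle.add {ξ ζ : L →ₗ[ℝ] (Dual ℝ L →ₗ[ℝ] L)} (hξ : IsCocycle ξ) (hζ : IsCocycle ζ) :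
    IsCocycle (ξ + ζ) := by
  intro u v
  simp only [LinearMap.add_apply, hξ u v, hζ u v, adDag_add]
  abel

lemma IsCocycle.sub {ξ ζ : L →ₗ[ℝ] (Dual ℝ L →ₗ[ℝ] L)} (hξ : IsCocycle ξ) (hζ : IsCocycle ζ) :
    IsCocycle (ξ - ζ) := by
  intro u v
  simp only [LinearMap.sub_apply, hξ u v, hζ u v, adDag_sub]
  abel

lemma isBivector_wedge (x y : L) : IsBivector (wedge x y) := by
  intro α β; simp; ring

lemma IsBivector.add {r s : Dual ℝ L →ₗ[ℝ] L} (hr : IsBivector r) (hs : IsBivector s) :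
    IsBivector (r + s) := by
  intro α β
  simp only [LinearMap.add_apply, map_add, hr α β, hs α β]
  ring

lemma IsBivector.sub {r s : Dual ℝ L →ₗ[ℝ] L} (hr : IsBivector r) (hs : IsBivector s) :
    IsBivector (r - s) := by
  intro α β
  simp only [LinearMap.sub_apply, map_sub, hr α β, hs α β]
  ring

lemma IsBivector.adDag {r : Dual ℝ L →ₗ[ℝ] L} (hr : IsBivector r) (u : L) :
    IsBivector (adDag u r) := by
  intro α β
  rw [apply_adDag, apply_adDag, hr (coad u α) β, hr α (coad u β)]
  ring

end Cocycles

namespace OscAlg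

section

variable {n : ℕ} {lam : Fin n → ℝ} {L : Type} [LieRing L] [LieAlgebra ℝ L] (B : OscAlg n lam L)

lemma isCocycle_wedge_e0 {D : L →ₗ[ℝ] L} (hD : IsDerivation D) :
    IsCocycle (wedgeLeft B.e0 ∘ₗ D) := by
  intro u v
  have h : ⁅D u, v⁆ = -⁅v, D u⁆ := (lie_skew _ _).symm
  simp only [LinearMap.comp_apply, wedgeLeft_apply, adDag_wedge, hD u v, h, lie_e0_right]
  ext α
  simp only [wedge_apply, LinearMap.add_apply, LinearMap.sub_apply, map_add, map_neg, map_zero]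
  module

@[simp] lemma Ja_em (a : Fin n → ℝ) : B.Ja a B.em = 0 := by simp [Ja, em]
@[simp] lemma Ja_e0 (a : Fin n → ℝ) : B.Ja a B.e0 = 0 := by simp [Ja, e0]
@[simp] lemma Ja_e (a : Fin n → ℝ) (i : Fin n) : B.Ja a (B.e i) = a i • B.f i := by
  simp [Ja, e]
@[simp] lemma Ja_f (a : Fin n → ℝ) (i : Fin n) : B.Ja a (B.f i) = -(a i • B.e i) := by
  rw [← neg_smul]; simp [Ja, f]

lemma isDerivation_Ja (a : Fin n → ℝ) : IsDerivation (B.Ja a) := by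
  intro x y
  let b : L →ₗ[ℝ] L →ₗ[ℝ] L := (LieAlgebra.ad ℝ L : L →ₗ[ℝ] Module.End ℝ L)
  suffices h : b.compr₂ (B.Ja a) = b.comp (B.Ja a) + b.compl₂ (B.Ja a) by
    simpa [b] using LinearMap.congr_fun₂ h x y
  refine B.linearMap_ext ?_ ?_ (fun i => ?_) (fun i => ?_) <;>
    refine B.linearMap_ext ?_ ?_ (fun j => ?_) (fun j => ?_) <;>
    simp [b] <;> first | exact smul_comm _ _ _ | (split_ifs <;> simp_all)

lemma isDerivation_Ja_add_ad (a : Fin n → ℝ) (u₀ : L) :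
    IsDerivation (B.Ja a + (LieAlgebra.ad ℝ L u₀ : L →ₗ[ℝ] L)) := by
  intro x y
  simp only [LinearMap.add_apply, B.isDerivation_Ja a x y, LieAlgebra.ad_apply, leibniz_lie u₀,
    add_lie, lie_add]
  abel

end

end OscAlg

/-! ### Normal form of a cocycle in dimension six -/

section Bivectors

variable {L : Type} [LieRing L] [LieAlgebra ℝ L]

lemma IsBivector.neg {r : Dual ℝ L →ₗ[ℝ] L} (hr : IsBivector r) : IsBivector (-r) := by
  intro α β
  simp only [LinearMap.neg_apply, map_neg, hr α β]

lemma IsBivector.smul {r : Dual ℝ L →ₗ[ℝ] L} (hr : IsBivector r) (t : ℝ) :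
    IsBivector (t • r) := by
  intro α β
  simp only [LinearMap.smul_apply, map_smul, hr α β, smul_neg]

end Bivectors

namespace OscAlg

variable {lam : Fin 2 → ℝ} {L : Type} [LieRing L] [LieAlgebra ℝ L] (B : OscAlg 2 lam L)

/-- The bivectors spanned by `t₁, t₂, E₁₂, Ě₁₂, F₁₂, F̌₁₂`. -/
def bivS (c : Fin 2 → ℝ) (d dc b bc : ℝ) : Dual ℝ L →ₗ[ℝ] L :=
  c 0 • B.tI 0 + c 1 • B.tI 1 + d • B.E12 + dc • B.E12c + b • B.F12 + bc • B.F12c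

/-- The element of `S` with the given coordinates. -/
def vecS (x y : Fin 2 → ℝ) : L := ∑ i, (x i • B.e i + y i • B.f i)

lemma vecS_mem (x y : Fin 2 → ℝ) : B.vecS x y ∈ B.S :=
  Submodule.sum_mem _ fun i _ => Submodule.add_mem _
    (Submodule.smul_mem _ _ (Submodule.subset_span (Or.inl ⟨i, rfl⟩)))
    (Submodule.smul_mem _ _ (Submodule.subset_span (Or.inr ⟨i, rfl⟩)))

lemma isBivector_bivS (c : Fin 2 → ℝ) (d dc b bc : ℝ) : IsBivector (B.bivS c d dc b bc) := by
  have h (x y : L) := isBivector_wedge x y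
  exact ((((((h _ _).smul _).add ((h _ _).smul _)).add (((h _ _).add (h _ _)).smul _)).add
    (((h _ _).neg.add (h _ _)).smul _)).add (((h _ _).neg.add (h _ _)).smul _)).add
    (((h _ _).add (h _ _)).smul _)

lemma adDag_em_bivS (c : Fin 2 → ℝ) (d dc b bc : ℝ) :
    adDag B.em (B.bivS c d dc b bc) =
      B.bivS 0 (-((lam 0 + lam 1) * dc)) ((lam 0 + lam 1) * d)
        (-((lam 1 - lam 0) * bc)) ((lam 1 - lam 0) * b) := by
  simp only [bivS, tI, E12, E12c, F12, F12c, adDag_add, adDag_smul, adDag_neg, adDag_wedge]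
  ext α
  simp
  module

/-- The general cocycle on a six-dimensional oscillator algebra. -/
def stdCocycle (c : Fin 2 → ℝ) (d dc b bc : ℝ) (w : L) (a : Fin 2 → ℝ) (u₀ : L) :
    L →ₗ[ℝ] (Dual ℝ L →ₗ[ℝ] L) :=
  coboundary (B.bivS c d dc b bc + wedge B.em w)
    + wedgeLeft B.e0 ∘ₗ (B.Ja a + (LieAlgebra.ad ℝ L u₀ : L →ₗ[ℝ] L))

lemma stdCocycle_apply (c : Fin 2 → ℝ) (d dc b bc : ℝ) (w : L) (a : Fin 2 → ℝ) (u₀ u : L) :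
    B.stdCocycle c d dc b bc w a u₀ u = adDag u (B.bivS c d dc b bc + wedge B.em w)
      + wedge B.e0 ((B.Ja a + (LieAlgebra.ad ℝ L u₀ : L →ₗ[ℝ] L)) u) := rfl

lemma isBivector_stdCocycle (c : Fin 2 → ℝ) (d dc b bc : ℝ) (w : L) (a : Fin 2 → ℝ) (u₀ u : L) :
    IsBivector (B.stdCocycle c d dc b bc w a u₀ u) :=
  (((B.isBivector_bivS c d dc b bc).add (isBivector_wedge _ _)).adDag u).add
    (isBivector_wedge _ _)

lemma isCocycle_stdCocycle (c : Fin 2 → ℝ) (d dc b bc : ℝ) (w : L) (a : Fin 2 → ℝ) (u₀ : L) :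
    IsCocycle (B.stdCocycle c d dc b bc w a u₀) :=
  (isCocycle_coboundary _).add (B.isCocycle_wedge_e0 (B.isDerivation_Ja_add_ad a u₀))

variable (c : Fin 2 → ℝ) (d dc b bc : ℝ) (x y a p q : Fin 2 → ℝ)

lemma stdCocycle_em :
    B.stdCocycle c d dc b bc (B.vecS x y) a (B.vecS p q) B.em =
      B.bivS 0 (-((lam 0 + lam 1) * dc)) ((lam 0 + lam 1) * d)
        (-((lam 1 - lam 0) * bc)) ((lam 1 - lam 0) * b)
      + wedge B.em (B.vecS (fun i => -(lam i * y i)) (fun i => lam i * x i))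
      + wedge B.e0 (B.vecS (fun i => lam i * q i) (fun i => -(lam i * p i))) := by
  rw [stdCocycle_apply, adDag_add, adDag_em_bivS, adDag_wedge]
  ext α
  simp [vecS, Fin.sum_univ_two]
  module

lemma stdCocycle_e (k : Fin 2) :
    B.stdCocycle c d dc b bc (B.vecS x y) a (B.vecS p q) (B.e k) =
      wedge B.e0 (B.bivS c d dc b bc (B.f' k) + (a k • B.f k) - q k • B.e0)
      + y k • wedge B.em B.e0 - lam k • wedge (B.f k) (B.vecS x y) := by
  rw [stdCocycle_apply, adDag_add, adDag_wedge]
  simp only [bivS, tI, E12, E12c, F12, F12c, adDag_add, adDag_smul, adDag_neg, adDag_wedge]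
  ext α
  fin_cases k <;> simp [vecS, Fin.sum_univ_two] <;> module

lemma stdCocycle_f (k : Fin 2) :
    B.stdCocycle c d dc b bc (B.vecS x y) a (B.vecS p q) (B.f k) =
      wedge B.e0 (p k • B.e0 - B.bivS c d dc b bc (B.e' k) - a k • B.e k)
      - x k • wedge B.em B.e0 + lam k • wedge (B.e k) (B.vecS x y) := by
  rw [stdCocycle_apply, adDag_add, adDag_wedge]
  simp only [bivS, tI, E12, E12c, F12, F12c, adDag_add, adDag_smul, adDag_neg, adDag_wedge]
  ext α
  fin_cases k <;> simp [vecS, Fin.sum_univ_two] <;> module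

lemma stdCocycle_e0 (w u₀ : L) : B.stdCocycle c d dc b bc w a u₀ B.e0 = 0 := by
  ext α
  simp [stdCocycle_apply, adDag_apply]

lemma exists_eq_stdCocycle (h₀ : 0 < lam 0) (h₁ : lam 0 < lam 1)
    {ξ : L →ₗ[ℝ] (Dual ℝ L →ₗ[ℝ] L)} (hs : ∀ u, IsBivector (ξ u)) (hc : IsCocycle ξ) :
    ∃ (c : Fin 2 → ℝ) (d dc b bc : ℝ) (x y a p q : Fin 2 → ℝ),
      ξ = B.stdCocycle c d dc b bc (B.vecS x y) a (B.vecS p q) := by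
  have hne : ∀ i, lam i ≠ 0 := by
    intro i; fin_cases i
    exacts [h₀.ne', (h₀.trans h₁).ne']
  have hne₁ : lam 1 ≠ 0 := hne 1
  have hsum : lam 0 + lam 1 ≠ 0 := by linarith
  have hdif : lam 1 - lam 0 ≠ 0 := by linarith
  have hsq : ∀ j k, j ≠ k → lam j ^ 2 ≠ lam k ^ 2 := by
    intro j k hjk
    fin_cases j <;> fin_cases k <;> simp at hjk ⊢ <;> nlinarith
  have key (u : L) (α : Dual ℝ L) : α (ξ u α) = 0 := by linarith [hs u α α]
  refine ⟨fun k => -B.e' k (ξ (B.e k) B.e0'),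
    (B.f' 1 (ξ B.em (B.f' 0)) - B.e' 1 (ξ B.em (B.e' 0))) / (2 * (lam 0 + lam 1)),
    -(B.f' 1 (ξ B.em (B.e' 0)) + B.e' 1 (ξ B.em (B.f' 0))) / (2 * (lam 0 + lam 1)),
    (B.e' 1 (ξ B.em (B.e' 0)) + B.f' 1 (ξ B.em (B.f' 0))) / (2 * (lam 1 - lam 0)),
    (B.f' 1 (ξ B.em (B.e' 0)) - B.e' 1 (ξ B.em (B.f' 0))) / (2 * (lam 1 - lam 0)),
    fun j => B.f' j (ξ B.em B.em') / lam j, fun j => -B.e' j (ξ B.em B.em') / lam j,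
    fun k => B.f' k (ξ (B.e k) B.e0'),
    fun j => -B.f' j (ξ B.em B.e0') / lam j, fun j => B.e' j (ξ B.em B.e0') / lam j, ?_⟩
  rw [← sub_eq_zero]
  refine B.cocycle_eq_zero hne hsq
    (fun u => (hs u).sub (B.isBivector_stdCocycle _ _ _ _ _ _ _ _ u))
    (hc.sub (B.isCocycle_stdCocycle _ _ _ _ _ _ _ _)) ?_ ?_ ?_ ?_ ?_ ?_ ?_ ?_ ?_
  iterate 4
    · intro i
      rw [LinearMap.sub_apply, stdCocycle_em]
      fin_cases i <;> simp [bivS, tI, E12, E12c, F12, F12c, vecS, Fin.sum_univ_two] <;>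
        field_simp <;> ring
  · intro i j
    rw [LinearMap.sub_apply, stdCocycle_em]
    fin_cases i <;> fin_cases j <;>
      simp [bivS, tI, E12, E12c, F12, F12c, vecS, Fin.sum_univ_two, key,
        hs _ (B.e' 0) (B.e' 1)] <;>
      field_simp <;> ring
  · intro i j hij
    rw [LinearMap.sub_apply, stdCocycle_em]
    fin_cases i <;> fin_cases j <;>
      simp [bivS, tI, E12, E12c, F12, F12c, vecS, Fin.sum_univ_two,
        hs _ (B.f' 0) (B.e' 1)] at hij ⊢ <;>
      field_simp <;> ring
  · intro i j
    rw [LinearMap.sub_apply, stdCocycle_em]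
    fin_cases i <;> fin_cases j <;>
      simp [bivS, tI, E12, E12c, F12, F12c, vecS, Fin.sum_univ_two, key,
        hs _ (B.f' 0) (B.f' 1)] <;>
      field_simp <;> ring
  iterate 2
    · intro i
      rw [LinearMap.sub_apply, stdCocycle_e]
      fin_cases i <;> simp [bivS, tI, E12, E12c, F12, F12c, vecS, Fin.sum_univ_two]

end OscAlg

/-! ### The Jacobi identity -/

/-- If `(p + iq)(x - iy) = 0`, written in real coordinates, then one factor vanishes. -/
lemma zero_or_zero_of_rotation {p q x y : ℝ} (h : p * x + q * y = 0) (h' : p * y - q * x = 0) :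
    (p = 0 ∧ q = 0) ∨ (x = 0 ∧ y = 0) := by
  rw [← mul_self_add_mul_self_eq_zero, ← mul_self_add_mul_self_eq_zero, ← mul_eq_zero]
  linear_combination (p * x + q * y) * h + (p * y - q * x) * h'

section Jacobi

variable {L : Type} [LieRing L] [LieAlgebra ℝ L]

@[simp] lemma dualBr_apply (ξ : L →ₗ[ℝ] (Dual ℝ L →ₗ[ℝ] L)) (α β : Dual ℝ L) (u : L) :
    dualBr ξ α β u = β (ξ u α) := rfl

lemma IsBialgebra.jacobi {ξ : L →ₗ[ℝ] (Dual ℝ L →ₗ[ℝ] L)} (h : IsBialgebra ξ)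
    (α β γ : Dual ℝ L) (u : L) :
    γ (ξ u (dualBr ξ α β)) + α (ξ u (dualBr ξ β γ)) + β (ξ u (dualBr ξ γ α)) = 0 := by
  simpa using LinearMap.congr_fun (h.2.2 α β γ) u

end Jacobi

namespace OscAlg

variable {lam : Fin 2 → ℝ} {L : Type} [LieRing L] [LieAlgebra ℝ L] (B : OscAlg 2 lam L)

lemma dualBr_eq (ξ : L →ₗ[ℝ] (Dual ℝ L →ₗ[ℝ] L)) (α β : Dual ℝ L) :
    dualBr ξ α β = β (ξ B.em α) • B.em' + β (ξ B.e0 α) • B.e0'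
      + (β (ξ (B.e 0) α) • B.e' 0 + β (ξ (B.f 0) α) • B.f' 0
        + (β (ξ (B.e 1) α) • B.e' 1 + β (ξ (B.f 1) α) • B.f' 1)) := by
  simpa [Fin.sum_univ_two] using B.dual_eq_sum (dualBr ξ α β)

variable (c : Fin 2 → ℝ) (d dc b bc : ℝ) (x y a p q : Fin 2 → ℝ)

lemma vecS_eq_zero_of_isBialgebra (hlam : ∀ i, lam i ≠ 0)
    (h : IsBialgebra (B.stdCocycle c d dc b bc (B.vecS x y) a (B.vecS p q))) :
    B.vecS x y = 0 := by
  have key (k : Fin 2) : lam k * (x k * x k + y k * y k) = 0 := by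
    have := h.jacobi B.em' B.e0' (B.e' k) (B.e k)
    simp only [B.dualBr_eq, stdCocycle_em, stdCocycle_e0, stdCocycle_e, stdCocycle_f] at this
    fin_cases k <;>
      simp [bivS, tI, E12, E12c, F12, F12c, vecS, Fin.sum_univ_two, -mul_eq_zero] at this ⊢ <;>
      linear_combination this
  have key (k : Fin 2) : x k = 0 ∧ y k = 0 :=
    mul_self_add_mul_self_eq_zero.mp ((mul_eq_zero.mp (key k)).resolve_left (hlam k))
  simp [vecS, fun k => (key k).1, fun k => (key k).2]

end OscAlg

/-! ### Sufficient and necessary conditions for the dual bracket -/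

namespace OscAlg

section

variable {n : ℕ} {lam : Fin n → ℝ} {L : Type} [LieRing L] [LieAlgebra ℝ L] (B : OscAlg n lam L)

lemma em'_lie_em (x : L) : B.em' ⁅B.em, x⁆ = 0 :=
  LinearMap.congr_fun B.coad_em_em' x

lemma em'_eq_zero_of_mem {x : L} (hx : x ∈ B.S) : B.em' x = 0 := by
  have h : B.S ≤ LinearMap.ker B.em' := by
    refine Submodule.span_le.mpr ?_
    rintro _ (⟨i, rfl⟩ | ⟨i, rfl⟩) <;> simp
  exact h hx

variable {ξ : L →ₗ[ℝ] (Dual ℝ L →ₗ[ℝ] L)} {R : Dual ℝ L →ₗ[ℝ] L} {E : L →ₗ[ℝ] L}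

lemma dualBr_of_eq (hξ : ∀ u, ξ u = B.em' u • R + wedge B.e0 (E u)) (α β : Dual ℝ L) :
    dualBr ξ α β = β (R α) • B.em' + α B.e0 • (β ∘ₗ E) - β B.e0 • (α ∘ₗ E) := by
  ext u
  simp [hξ]
  ring

/-- A criterion for the Jacobi identity of the dual bracket. -/
lemma jacobi_of_dag_eq_zero (hξ : ∀ u, ξ u = B.em' u • R + wedge B.e0 (E u)) (hR : IsBivector R)
    (hRm : R B.em' = 0) (hE : E B.e0 = 0) (hmE : ∀ u, B.em' (E u) = 0) (hER : dag E R = 0)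
    (α β γ : Dual ℝ L) :
    dualBr ξ (dualBr ξ α β) γ + dualBr ξ (dualBr ξ β γ) α + dualBr ξ (dualBr ξ γ α) β = 0 := by
  have hT (α β : Dual ℝ L) : α (R (β ∘ₗ E)) = β (R (α ∘ₗ E)) := by
    have h : R (α ∘ₗ E) + E (R α) = 0 := LinearMap.congr_fun hER α
    rw [eq_neg_of_add_eq_zero_left h, hR, map_neg]
    rfl
  ext u
  simp only [B.dualBr_of_eq hξ, LinearMap.add_apply, LinearMap.sub_apply, LinearMap.smul_apply,
    map_add, map_sub, map_smul, smul_eq_mul, LinearMap.comp_apply, hRm, hE, hmE, map_zero, em'_e0,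
    hT β α, hT γ α, hT γ β, LinearMap.zero_apply]
  ring

/-- A necessary condition for the Jacobi identity of the dual bracket. -/
lemma dag_eq_zero_of_jacobi (hξ : ∀ u, ξ u = B.em' u • R + wedge B.e0 (E u)) (hR : IsBivector R)
    (hRm : R B.em' = 0) (hE : E B.e0 = 0) (hmE : ∀ u, B.em' (E u) = 0) (h : IsBialgebra ξ)
    {β γ : Dual ℝ L} (hβ : β B.e0 = 0) (hγ : γ B.e0 = 0) : γ (dag E R β) = 0 := by
  have hT : β (R (γ ∘ₗ E)) = -γ (E (R β)) := hR _ _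
  have hJ := LinearMap.congr_fun (h.2.2 B.e0' β γ) B.em
  simp only [B.dualBr_of_eq hξ, LinearMap.add_apply, LinearMap.sub_apply, LinearMap.smul_apply,
    map_add, map_sub, map_smul, smul_eq_mul, LinearMap.comp_apply, hRm, hE, hmE, map_zero, em'_e0,
    em'_em, e0'_e0, hβ, hγ, hT, LinearMap.zero_apply] at hJ
  change γ (R (β ∘ₗ E) + E (R β)) = 0
  rw [map_add]
  linarith

end

variable {lam : Fin 2 → ℝ} {L : Type} [LieRing L] [LieAlgebra ℝ L] (B : OscAlg 2 lam L)
variable (c : Fin 2 → ℝ) (d dc b bc : ℝ) (a : Fin 2 → ℝ)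

lemma adDag_wedge_of_em'_eq_zero (u : L) {x y : L} (hx : B.em' x = 0) (hy : B.em' y = 0) :
    adDag u (wedge x y) =
      B.em' u • adDag B.em (wedge x y) + wedge B.e0 (wedge x y (B.om u)) := by
  rw [adDag_wedge, adDag_wedge, B.lie_of_em'_eq_zero u hx, B.lie_of_em'_eq_zero u hy]
  ext α
  simp
  module

lemma adDag_bivS (u : L) :
    adDag u (B.bivS c d dc b bc) =
      B.em' u • adDag B.em (B.bivS c d dc b bc) + wedge B.e0 (B.bivS c d dc b bc (B.om u)) := by
  simp only [bivS, tI, E12, E12c, F12, F12c, adDag_add, adDag_smul, adDag_neg,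
    B.adDag_wedge_of_em'_eq_zero u, em'_e, em'_f]
  ext α
  simp only [LinearMap.add_apply, LinearMap.smul_apply, LinearMap.neg_apply, wedge_apply, map_add,
    map_smul, map_neg, map_sub]
  module

lemma dag_bivS (v : L) :
    dag (B.bivS c d dc b bc ∘ₗ B.om + B.Ja a - B.em'.smulRight v)
        (adDag B.em (B.bivS c d dc b bc)) =
      B.bivS 0
        (-((lam 0 + lam 1) * (d * (a 0 + a 1) - dc * (c 0 + c 1))))
        (-((lam 0 + lam 1) * (d * (c 0 + c 1) + dc * (a 0 + a 1))))
        ((lam 1 - lam 0) * (b * (a 0 - a 1) + bc * (c 0 + c 1)))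
        ((lam 1 - lam 0) * (bc * (a 0 - a 1) - b * (c 0 + c 1))) := by
  rw [adDag_em_bivS]
  ext α
  simp [dag, bivS, tI, E12, E12c, F12, F12c, om, Fin.sum_univ_two]
  module

/-- The endomorphism governing the part `e₀ ∧ E(u)` of a standard cocycle. -/
def innerPart (u₀ : L) : L →ₗ[ℝ] L :=
  B.bivS c d dc b bc ∘ₗ B.om + B.Ja a - B.em'.smulRight ⁅B.em, u₀⁆

lemma innerPart_e0 (u₀ : L) : B.innerPart c d dc b bc a u₀ B.e0 = 0 := by
  simp [innerPart, om]

lemma em'_innerPart (u₀ u : L) : B.em' (B.innerPart c d dc b bc a u₀ u) = 0 := by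
  have hJ : B.em' ∘ₗ B.Ja a = 0 := by
    refine B.linearMap_ext ?_ ?_ (fun i => ?_) (fun i => ?_) <;> simp
  have hJu : B.em' (B.Ja a u) = 0 := LinearMap.congr_fun hJ u
  simp [innerPart, bivS, tI, E12, E12c, F12, F12c, em'_lie_em, hJu]

lemma adDag_em_bivS_em' : adDag B.em (B.bivS c d dc b bc) B.em' = 0 := by
  rw [adDag_em_bivS]
  simp [bivS, tI, E12, E12c, F12, F12c]

lemma stdCocycle_eq_innerPart {u₀ : L} (hu : u₀ ∈ B.S) (u : L) :
    B.stdCocycle c d dc b bc 0 a u₀ u = B.em' u • adDag B.em (B.bivS c d dc b bc)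
      + wedge B.e0 (B.innerPart c d dc b bc a u₀ u) := by
  have hz : wedge B.em (0 : L) = 0 := by ext; simp
  have hl : ⁅u₀, u⁆ = -(B.em' u • ⁅B.em, u₀⁆ + B.om u u₀ • B.e0) := by
    rw [← B.lie_of_em'_eq_zero u (B.em'_eq_zero_of_mem hu), lie_skew]
  rw [stdCocycle_apply, hz, add_zero, adDag_bivS]
  ext α
  simp only [LinearMap.add_apply, LieAlgebra.ad_apply, hl]
  simp [innerPart]
  module

lemma isBialgebra_stdCocycle {u₀ : L} (hu : u₀ ∈ B.S)
    (h : (d = 0 ∧ dc = 0) ∨ (c 0 + c 1 = 0 ∧ a 0 + a 1 = 0))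
    (h' : (b = 0 ∧ bc = 0) ∨ (c 0 + c 1 = 0 ∧ a 0 - a 1 = 0)) :
    IsBialgebra (B.stdCocycle c d dc b bc 0 a u₀) := by
  refine ⟨B.isBivector_stdCocycle _ _ _ _ _ _ _ _, B.isCocycle_stdCocycle _ _ _ _ _ _ _ _,
    B.jacobi_of_dag_eq_zero (B.stdCocycle_eq_innerPart c d dc b bc a hu)
      ((B.isBivector_bivS _ _ _ _ _).adDag _) (B.adDag_em_bivS_em' _ _ _ _ _)
      (B.innerPart_e0 _ _ _ _ _ _ _) (B.em'_innerPart _ _ _ _ _ _ _) ?_⟩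
  rw [innerPart, dag_bivS]
  rcases h with ⟨rfl, rfl⟩ | ⟨h₁, h₂⟩ <;> rcases h' with ⟨rfl, rfl⟩ | ⟨h₃, h₄⟩ <;>
    simp [bivS, *]

lemma coefficients_of_isBialgebra (h₀ : 0 < lam 0) (h₁ : lam 0 < lam 1) {u₀ : L} (hu : u₀ ∈ B.S)
    (h : IsBialgebra (B.stdCocycle c d dc b bc 0 a u₀)) :
    ((d = 0 ∧ dc = 0) ∨ (c 0 + c 1 = 0 ∧ a 0 + a 1 = 0)) ∧
      ((b = 0 ∧ bc = 0) ∨ (c 0 + c 1 = 0 ∧ a 0 - a 1 = 0)) := by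
  have key {β γ : Dual ℝ L} (hβ : β B.e0 = 0) (hγ : γ B.e0 = 0) :=
    B.dag_eq_zero_of_jacobi (B.stdCocycle_eq_innerPart c d dc b bc a hu)
      ((B.isBivector_bivS _ _ _ _ _).adDag _) (B.adDag_em_bivS_em' _ _ _ _ _)
      (B.innerPart_e0 _ _ _ _ _ _ _) (B.em'_innerPart _ _ _ _ _ _ _) h hβ hγ
  simp only [innerPart, dag_bivS] at key
  have k₁ := key (B.e'_e0 0) (B.e'_e0 1)
  have k₂ := key (B.e'_e0 0) (B.f'_e0 1)
  have k₃ := key (B.f'_e0 0) (B.e'_e0 1)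
  have k₄ := key (B.f'_e0 0) (B.f'_e0 1)
  simp [bivS, tI, E12, E12c, F12, F12c] at k₁ k₂ k₃ k₄
  have hsum : lam 0 + lam 1 ≠ 0 := by linarith
  have hdif : lam 1 - lam 0 ≠ 0 := by linarith
  constructor
  · refine zero_or_zero_of_rotation (mul_left_cancel₀ hsum ?_) (mul_left_cancel₀ hsum ?_)
    · linear_combination (k₁ - k₄) / 2
    · linear_combination -(k₂ + k₃) / 2
  · rw [← neg_eq_zero (a := a 0 - a 1)]
    refine zero_or_zero_of_rotation (mul_left_cancel₀ hdif ?_) (mul_left_cancel₀ hdif ?_)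
    · linear_combination -(k₁ + k₄) / 2
    · linear_combination (k₂ - k₃) / 2

end OscAlg

/-- **Proposition (dimension 6, bialgebras).** On the 6-dimensional oscillator Lie
algebra `𝔤_λ` with `0 < λ₁ < λ₂`, a linear map `ξ : 𝔤_λ → ⋀²𝔤_λ` is a Lie bialgebra
structure iff it has one of the four listed forms. -/
theorem oscillator_dim6_bialgebra_classification
    {lam : Fin 2 → ℝ} (hlam : 0 < lam 0 ∧ lam 0 < lam 1)
    {L : Type} [LieRing L] [LieAlgebra ℝ L] (B : OscAlg 2 lam L)
    (ξ : L →ₗ[ℝ] (Dual ℝ L →ₗ[ℝ] L)) :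
    IsBialgebra ξ ↔
      ((∃ (c₁ c₂ : ℝ) (a : Fin 2 → ℝ) (u₀ : L), u₀ ∈ B.S ∧
          ∀ u : L, ξ u = adDag u (c₁ • B.tI 0 + c₂ • B.tI 1)
            + wedge B.e0 ((B.Ja a + (LieAlgebra.ad ℝ L u₀ : L →ₗ[ℝ] L)) u)) ∨
       (∃ (a d dc c : ℝ) (u₀ : L), u₀ ∈ B.S ∧
          ∀ u : L, ξ u = adDag u (d • B.E12 + dc • B.E12c + c • (B.tI 0 - B.tI 1))
            + wedge B.e0 ((B.Ja ![a, -a] + (LieAlgebra.ad ℝ L u₀ : L →ₗ[ℝ] L)) u)) ∨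
       (∃ (a d dc c : ℝ) (u₀ : L), u₀ ∈ B.S ∧
          ∀ u : L, ξ u = adDag u (d • B.F12 + dc • B.F12c + c • (B.tI 0 - B.tI 1))
            + wedge B.e0 ((B.Ja ![a, a] + (LieAlgebra.ad ℝ L u₀ : L →ₗ[ℝ] L)) u)) ∨
       (∃ (b bc d dc c : ℝ) (u₀ : L), u₀ ∈ B.S ∧
          ∀ u : L, ξ u = adDag u (d • B.E12 + dc • B.E12c + b • B.F12 + bc • B.F12c
              + c • (B.tI 0 - B.tI 1))
            + wedge B.e0 ⁅u₀, u⁆)) := by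
  obtain ⟨h₀, h₁⟩ := hlam
  have hz : wedge B.em (0 : L) = 0 := by ext; simp
  have hJ : B.Ja 0 = 0 := by
    refine B.linearMap_ext ?_ ?_ (fun i => ?_) (fun i => ?_) <;> simp
  constructor
  · intro h
    obtain ⟨c, d, dc, b, bc, x, y, a, p, q, rfl⟩ := B.exists_eq_stdCocycle h₀ h₁ h.1 h.2.1
    have hne : ∀ i, lam i ≠ 0 := by
      intro i
      fin_cases i
      exacts [h₀.ne', (h₀.trans h₁).ne']
    have hw := B.vecS_eq_zero_of_isBialgebra _ _ _ _ _ _ _ _ _ _ hne h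
    rw [hw] at h
    have hu := B.vecS_mem p q
    have hd := B.coefficients_of_isBialgebra _ _ _ _ _ _ h₀ h₁ hu h
    simp only [OscAlg.stdCocycle_apply, hw, hz, add_zero]
    rcases hd with ⟨⟨rfl, rfl⟩ | ⟨hC, hA⟩, ⟨rfl, rfl⟩ | ⟨hC', hA'⟩⟩
    · refine Or.inl ⟨c 0, c 1, a, _, hu, fun u => ?_⟩
      simp [OscAlg.bivS]
    · refine Or.inr (Or.inr (Or.inl ⟨a 0, b, bc, c 0, _, hu, fun u => ?_⟩))
      have ha : ![a 0, a 0] = a := by ext i; fin_cases i <;> simp; linarith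
      have hr : b • B.F12 + bc • B.F12c + c 0 • (B.tI 0 - B.tI 1) = B.bivS c 0 0 b bc := by
        rw [OscAlg.bivS, eq_neg_of_add_eq_zero_right hC']; module
      rw [ha, hr]
    · refine Or.inr (Or.inl ⟨a 0, d, dc, c 0, _, hu, fun u => ?_⟩)
      have ha : ![a 0, -a 0] = a := by ext i; fin_cases i <;> simp; linarith
      have hr : d • B.E12 + dc • B.E12c + c 0 • (B.tI 0 - B.tI 1) = B.bivS c d dc 0 0 := by
        rw [OscAlg.bivS, eq_neg_of_add_eq_zero_right hC]; module
      rw [ha, hr]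
    · refine Or.inr (Or.inr (Or.inr ⟨b, bc, d, dc, c 0, _, hu, fun u => ?_⟩))
      have ha : a = 0 := by ext i; fin_cases i <;> simp <;> linarith
      have hr : d • B.E12 + dc • B.E12c + b • B.F12 + bc • B.F12c + c 0 • (B.tI 0 - B.tI 1)
          = B.bivS c d dc b bc := by
        rw [OscAlg.bivS, eq_neg_of_add_eq_zero_right hC]; module
      rw [ha, hr, hJ, zero_add, LieAlgebra.ad_apply]
  · have key (c : Fin 2 → ℝ) (d dc b bc : ℝ) (a : Fin 2 → ℝ) (u₀ : L) (hu : u₀ ∈ B.S)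
        (h : (d = 0 ∧ dc = 0) ∨ (c 0 + c 1 = 0 ∧ a 0 + a 1 = 0))
        (h' : (b = 0 ∧ bc = 0) ∨ (c 0 + c 1 = 0 ∧ a 0 - a 1 = 0))
        (hξ : ∀ u, ξ u = adDag u (B.bivS c d dc b bc)
          + wedge B.e0 ((B.Ja a + (LieAlgebra.ad ℝ L u₀ : L →ₗ[ℝ] L)) u)) : IsBialgebra ξ := by
      have : ξ = B.stdCocycle c d dc b bc 0 a u₀ :=
        LinearMap.ext fun u => by rw [hξ, OscAlg.stdCocycle_apply, hz, add_zero]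
      exact this ▸ B.isBialgebra_stdCocycle _ _ _ _ _ _ hu h h'
    rintro (⟨c₁, c₂, a, u₀, hu, hξ⟩ | ⟨a, d, dc, c, u₀, hu, hξ⟩ | ⟨a, d, dc, c, u₀, hu, hξ⟩ |
      ⟨b, bc, d, dc, c, u₀, hu, hξ⟩)
    · refine key ![c₁, c₂] 0 0 0 0 a u₀ hu (by simp) (by simp) fun u => ?_
      rw [hξ]
      simp [OscAlg.bivS]
    · refine key ![c, -c] d dc 0 0 ![a, -a] u₀ hu (by simp) (by simp) fun u => ?_
      rw [hξ]
      congr 2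
      simp only [OscAlg.bivS, Matrix.cons_val_zero, Matrix.cons_val_one]
      module
    · refine key ![c, -c] 0 0 d dc ![a, a] u₀ hu (by simp) (by simp) fun u => ?_
      rw [hξ]
      congr 2
      simp only [OscAlg.bivS, Matrix.cons_val_zero, Matrix.cons_val_one]
      module
    · refine key ![c, -c] d dc b bc 0 u₀ hu (by simp) (by simp) fun u => ?_
      rw [hξ, hJ, zero_add, LieAlgebra.ad_apply]
      congr 2
      simp only [OscAlg.bivS, Matrix.cons_val_zero, Matrix.cons_val_one]
      module
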